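/- arXiv:2006.15885 — 4 statements merged into one kernel-verified Lean document; each statement's English description precedes it below -/
import Mathlib

section
/- Let R > 0 and let f : ℝ³ → ℝ be smooth with compact support contained in the closed ball B(0,R). Set ψ(z) = ‖z‖, ψ^R(z) = χ_{[-2R,2R]³}(z) ‖z‖, g = ψ⋆f and g^R = ψ^R⋆f. Then the Landau collision operator is unchanged by this truncation: for every v ∈ ℝ³, ∇·(∇²g(v) ∇f(v) − ∇(Δg)(v) f(v)) = ∇·(∇²g^R(v) ∇f(v) − ∇(Δg^R)(v) f(v)). -/
open Real MeasureTheory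
noncomputable section

/-- Partial derivative in the `i`-th coordinate direction. -/
def pd (i : Fin 3) (f : EuclideanSpace ℝ (Fin 3) → ℝ) :
    EuclideanSpace ℝ (Fin 3) → ℝ :=
  fun v => fderiv ℝ f v (EuclideanSpace.single i 1)

/-- The Laplacian `Δf = Σ_j ∂_j² f`. -/
def lap (f : EuclideanSpace ℝ (Fin 3) → ℝ) : EuclideanSpace ℝ (Fin 3) → ℝ :=
  fun v => ∑ j, pd j (pd j f) v

/-- The Coulombian Landau operator in Rosenbluth form:
`∇·(∇²g ∇f − ∇(Δg) f)`. -/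
def landauOp (g f : EuclideanSpace ℝ (Fin 3) → ℝ)
    (v : EuclideanSpace ℝ (Fin 3)) : ℝ :=
  ∑ i, pd i (fun w => (∑ j, pd i (pd j g) w * pd j f w) - pd i (lap g) w * f w) v

/-- The truncated Coulombian kernel `ψ^R(z) = χ_{[-2R,2R]³}(z) ‖z‖`. -/
def psiR (R : ℝ) (z : EuclideanSpace ℝ (Fin 3)) : ℝ :=
  Set.indicator {u : EuclideanSpace ℝ (Fin 3) | ∀ i, |u i| ≤ 2 * R}
    (fun u => ‖u‖) z

theorem pd_congr_ev {g h : EuclideanSpace ℝ (Fin 3) → ℝ} {w : EuclideanSpace ℝ (Fin 3)}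
    (i : Fin 3) (e : g =ᶠ[nhds w] h) : pd i g =ᶠ[nhds w] pd i h := by
  filter_upwards [e.fderiv (𝕜 := ℝ)] with x hx
  simp only [pd, hx]

theorem lap_congr_ev {g h : EuclideanSpace ℝ (Fin 3) → ℝ} {w : EuclideanSpace ℝ (Fin 3)}
    (e : g =ᶠ[nhds w] h) : lap g =ᶠ[nhds w] lap h := by
  have := fun j : Fin 3 => pd_congr_ev j (pd_congr_ev j e)
  filter_upwards [Filter.eventually_all.2 this] with x hx
  simp only [lap, hx]

theorem zero_outside {R : ℝ} (hR : 0 < R) {h : EuclideanSpace ℝ (Fin 3) → ℝ}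
    (hc : Continuous h) (h0 : ∀ x ∉ Metric.closedBall (0 : EuclideanSpace ℝ (Fin 3)) R, h x = 0)
    (w : EuclideanSpace ℝ (Fin 3)) (hw : w ∉ Metric.ball (0 : EuclideanSpace ℝ (Fin 3)) R) :
    h w = 0 := by
  have h1 : closure (Metric.closedBall (0 : EuclideanSpace ℝ (Fin 3)) R)ᶜ ⊆ {x | h x = 0} :=
    closure_minimal (fun x hx => h0 x hx) (isClosed_eq hc continuous_const)
  apply h1
  rw [closure_compl, interior_closedBall _ hR.ne']
  exact hw

/-- For `f` smooth with compact support in `B(0,R)`, the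
Landau collision operator in Rosenbluth form is unchanged when the Rosenbluth
potential `g = ψ⋆f` is replaced by its truncation `g^R = ψ^R⋆f`. -/
theorem landauOp_truncation
    (R : ℝ) (hR : 0 < R) (f : EuclideanSpace ℝ (Fin 3) → ℝ)
    (hf : ContDiff ℝ (⊤ : ℕ∞) f)
    (hsupp : tsupport f ⊆ Metric.closedBall 0 R)
    (v : EuclideanSpace ℝ (Fin 3)) :
    landauOp (fun x => ∫ u, ‖u‖ * f (x - u)) f v
      = landauOp (fun x => ∫ u, psiR R u * f (x - u)) f v := by
  have hf0 : ∀ x ∉ Metric.closedBall (0 : EuclideanSpace ℝ (Fin 3)) R, f x = 0 :=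
    fun x hx => image_eq_zero_of_notMem_tsupport (fun h => hx (hsupp h))
  have hpd0 : ∀ j, ∀ x ∉ Metric.closedBall (0 : EuclideanSpace ℝ (Fin 3)) R, pd j f x = 0 := by
    intro j x hx
    have : fderiv ℝ f x = 0 :=
      image_eq_zero_of_notMem_tsupport
        (fun h => hx (hsupp (tsupport_fderiv_subset ℝ h)))
    simp [pd, this]
  have hpdc : ∀ j, Continuous (pd j f) := fun j =>
    (hf.continuous_fderiv (by simp)).clm_apply continuous_const
  have key : ∀ x ∈ Metric.ball (0 : EuclideanSpace ℝ (Fin 3)) R,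
      (∫ u, ‖u‖ * f (x - u)) = ∫ u, psiR R u * f (x - u) := by
    intro x hx
    congr 1
    funext u
    by_cases hu : x - u ∈ Metric.closedBall (0 : EuclideanSpace ℝ (Fin 3)) R
    · have hm : u ∈ {u : EuclideanSpace ℝ (Fin 3) | ∀ i, |u i| ≤ 2 * R} := by
        intro i
        have h1 : ‖u i‖ ≤ ‖u‖ := PiLp.norm_apply_le u i
        rw [Real.norm_eq_abs] at h1
        have h2 : ‖u‖ ≤ ‖x‖ + ‖x - u‖ := by
          have := norm_sub_le x (x - u)
          simpa using this
        simp only [mem_ball_zero_iff, mem_closedBall_zero_iff] at hx hu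
        linarith
      simp only [psiR, Set.indicator_of_mem hm]
    · simp [hf0 _ hu]
  unfold landauOp
  refine Finset.sum_congr rfl fun i _ => ?_
  congr 1
  funext w
  by_cases hw : w ∈ Metric.ball (0 : EuclideanSpace ℝ (Fin 3)) R
  · have e : (fun x => ∫ u, ‖u‖ * f (x - u)) =ᶠ[nhds w] fun x => ∫ u, psiR R u * f (x - u) := by
      filter_upwards [Metric.isOpen_ball.mem_nhds hw] with x hx using key x hx
    rw [(pd_congr_ev i (lap_congr_ev e)).eq_of_nhds]
    congr 1
    refine Finset.sum_congr rfl fun j _ => ?_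
    rw [(pd_congr_ev i (pd_congr_ev j e)).eq_of_nhds]
  · have a := zero_outside hR hf.continuous hf0 w hw
    have b := fun j => zero_outside hR (hpdc j) (hpd0 j) w hw
    simp [a, b]
end
end

section
/- Let f : ℝ³ → ℝ be smooth with compact support and let ψ(z) = ‖z‖. Then g = ψ⋆f is smooth and its Hessian is given by convolution with the Landau kernel: for every v ∈ ℝ³ and all i, j ∈ {1,2,3}, ∂_i∂_j g(v) = ∫_{ℝ³} A_{ij}(v−w) f(w) dw, where A(z) = ‖z‖⁻¹ (I − z⊗z/‖z‖²) for z ≠ 0 (the integrand is defined for almost every w and is locally integrable). -/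
open Real MeasureTheory
noncomputable section

/-- The Landau collision kernel matrix for Coulombian interactions:
`A(z) = ‖z‖⁻¹ (I − z⊗z/‖z‖²)` (with the Lean convention `0⁻¹ = 0` at `z = 0`). -/
def landauKernel (z : EuclideanSpace ℝ (Fin 3)) : Fin 3 → Fin 3 → ℝ :=
  fun i j => ‖z‖⁻¹ * ((if i = j then (1 : ℝ) else 0) - z i * z j / ‖z‖ ^ 2)

open Filter Topology


lemma pd_contDiff {g : (EuclideanSpace ℝ (Fin 3)) → ℝ} (hg : ContDiff ℝ (⊤ : ℕ∞) g) (i : Fin 3) :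
    ContDiff ℝ (⊤ : ℕ∞) (pd i g) := by
  unfold pd
  exact (hg.fderiv_right (m := (⊤ : ℕ∞)) (by simp)).clm_apply contDiff_const

lemma pd_hcs {g : (EuclideanSpace ℝ (Fin 3)) → ℝ} (hg : HasCompactSupport g) (i : Fin 3) :
    HasCompactSupport (pd i g) := by
  unfold pd
  exact hg.fderiv_apply ℝ _

lemma hcs_sub {g : (EuclideanSpace ℝ (Fin 3)) → ℝ} (hg : HasCompactSupport g) (v : (EuclideanSpace ℝ (Fin 3))) :
    HasCompactSupport (fun u => g (v - u)) :=
  hg.comp_homeomorph (Homeomorph.subLeft v)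

lemma int_conv {k g : (EuclideanSpace ℝ (Fin 3)) → ℝ} (hk : LocallyIntegrable k) (hg : Continuous g)
    (hs : HasCompactSupport g) (v : (EuclideanSpace ℝ (Fin 3))) : Integrable (fun u => k u * g (v - u)) := by
  have := hk.integrable_smul_right_of_hasCompactSupport
    (g := fun u => g (v - u)) (by fun_prop) (hcs_sub hs v)
  simpa using this

lemma pd_conv {k g : (EuclideanSpace ℝ (Fin 3)) → ℝ} (hk : LocallyIntegrable k) (hg : ContDiff ℝ (⊤ : ℕ∞) g)
    (hs : HasCompactSupport g) (i : Fin 3) :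
    pd i (fun x => ∫ u, k u * g (x - u)) = fun x => ∫ u, k u * pd i g (x - u) := by
  funext x
  have hg1 : ContDiff ℝ 1 g := hg.of_le (by exact_mod_cast le_top)
  have h := hs.hasFDerivAt_convolution_right (ContinuousLinearMap.mul ℝ ℝ) (μ := volume) hk hg1 x
  have h2 : HasFDerivAt (fun x => ∫ u, k u * g (x - u)) _ x := h
  unfold pd
  rw [h2.fderiv]
  have hex := (hs.fderiv ℝ).convolutionExists_right
    ((ContinuousLinearMap.mul ℝ ℝ).precompR (EuclideanSpace ℝ (Fin 3))) (μ := volume) hk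
    (hg1.continuous_fderiv one_ne_zero) x
  unfold convolution
  rw [ContinuousLinearMap.integral_apply hex]
  rfl

lemma ibp {k g : (EuclideanSpace ℝ (Fin 3)) → ℝ} (hk : ContDiff ℝ (⊤ : ℕ∞) k) (hg : ContDiff ℝ (⊤ : ℕ∞) g)
    (hs : HasCompactSupport g) (i : Fin 3) (v : (EuclideanSpace ℝ (Fin 3))) :
    ∫ u, k u * pd i g (v - u) = ∫ u, pd i k u * g (v - u) := by
  have hgd : Differentiable ℝ g := hg.differentiable (by simp)
  have hkd : Differentiable ℝ k := hk.differentiable (by simp)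
  have hd : ∀ u, fderiv ℝ (fun u => g (v - u)) u (EuclideanSpace.single i 1) = - pd i g (v - u) := by
    intro u
    have h : HasFDerivAt (fun u => g (v - u)) _ u :=
      (hgd (v - u)).hasFDerivAt.comp u ((hasFDerivAt_id u).const_sub v)
    rw [h.fderiv]
    simp [pd]
  have h1 := int_conv (pd_contDiff hk i).continuous.locallyIntegrable hg.continuous hs v
  have h2 := int_conv hk.continuous.locallyIntegrable (pd_contDiff hg i).continuous (pd_hcs hs i) v
  have h3 := int_conv hk.continuous.locallyIntegrable hg.continuous hs v
  have := integral_mul_fderiv_eq_neg_fderiv_mul_of_integrable (μ := (volume : Measure (EuclideanSpace ℝ (Fin 3))))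
    (f := k) (g := fun u => g (v - u)) (v := EuclideanSpace.single i 1) h1
    (by simp only [hd, mul_neg]; exact h2.neg) h3 (fun x _ => hkd x)
    (fun x _ => (hgd _).comp x (by fun_prop))
  simp only [hd, mul_neg, integral_neg, neg_inj] at this
  exact this

/-- Regularized norm. -/
def regK (e : ℝ) (z : (EuclideanSpace ℝ (Fin 3))) : ℝ := √(‖z‖ ^ 2 + e ^ 2)

lemma regK_pos {e : ℝ} (he : 0 < e) (z : (EuclideanSpace ℝ (Fin 3))) : 0 < regK e z :=
  Real.sqrt_pos.2 (by positivity)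

lemma regK_contDiff {e : ℝ} (he : 0 < e) : ContDiff ℝ (⊤ : ℕ∞) (regK e) := by
  unfold regK
  exact ((contDiff_norm_sq ℝ).add contDiff_const).sqrt (fun z => by positivity)

lemma regK_hasFDerivAt {e : ℝ} (he : 0 < e) (z : (EuclideanSpace ℝ (Fin 3))) :
    HasFDerivAt (regK e) ((regK e z)⁻¹ • innerSL ℝ z) z := by
  have h1 : HasFDerivAt (fun z : (EuclideanSpace ℝ (Fin 3)) => ‖z‖ ^ 2 + e ^ 2) (2 • innerSL ℝ z) z :=
    (hasStrictFDerivAt_norm_sq z).hasFDerivAt.add_const _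
  have h2 := h1.sqrt (by positivity)
  have h3 : (regK e z)⁻¹ • innerSL ℝ z = (1 / (2 * √(‖z‖ ^ 2 + e ^ 2))) • 2 • innerSL ℝ z := by
    ext w
    have := (regK_pos he z).ne'
    simp only [regK] at this
    simp [regK]
    field_simp
  rw [h3]
  exact h2

lemma inner_single_one (z : (EuclideanSpace ℝ (Fin 3))) (i : Fin 3) : inner ℝ z (EuclideanSpace.single i (1 : ℝ)) = z i := by
  have := EuclideanSpace.inner_single_right (𝕜 := ℝ) i (1 : ℝ) z
  simpa using this

lemma pd_regK {e : ℝ} (he : 0 < e) (i : Fin 3) :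
    pd i (regK e) = fun z => (regK e z)⁻¹ * z i := by
  funext z
  unfold pd
  rw [(regK_hasFDerivAt he z).fderiv]
  simp [inner_single_one]

lemma pd_pd_regK {e : ℝ} (he : 0 < e) (i j : Fin 3) (z : (EuclideanSpace ℝ (Fin 3))) :
    pd j (pd i (regK e)) z =
      (regK e z)⁻¹ * ((if i = j then (1 : ℝ) else 0) - z i * z j / (regK e z) ^ 2) := by
  rw [pd_regK he]
  have hp := (regK_pos he z).ne'
  have h1 := (hasFDerivAt_inv hp).comp z (regK_hasFDerivAt he z)
  have h2 : HasFDerivAt (fun z : (EuclideanSpace ℝ (Fin 3)) => z i) (EuclideanSpace.proj i : (EuclideanSpace ℝ (Fin 3)) →L[ℝ] ℝ) z :=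
    (EuclideanSpace.proj i : (EuclideanSpace ℝ (Fin 3)) →L[ℝ] ℝ).hasFDerivAt
  have h3 : HasFDerivAt (fun z : (EuclideanSpace ℝ (Fin 3)) => (regK e z)⁻¹ * z i) _ z := h1.mul h2
  unfold pd
  rw [h3.fderiv]
  simp [inner_single_one]
  split_ifs <;> field_simp <;> ring

lemma norm_le_regK (e : ℝ) (z : (EuclideanSpace ℝ (Fin 3))) : ‖z‖ ≤ regK e z :=
  Real.le_sqrt_of_sq_le (by nlinarith [sq_nonneg e])

lemma regK_le {e : ℝ} (he : 0 < e) (he1 : e ≤ 1) (z : (EuclideanSpace ℝ (Fin 3))) : regK e z ≤ ‖z‖ + 1 :=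
  Real.sqrt_le_iff.2 ⟨by positivity, by nlinarith [norm_nonneg z]⟩

lemma kern_bound {r : ℝ} (z : (EuclideanSpace ℝ (Fin 3))) (hz : z ≠ 0) (hr : ‖z‖ ≤ r) (i j : Fin 3) :
    |r⁻¹ * ((if i = j then (1 : ℝ) else 0) - z i * z j / r ^ 2)| ≤ 2 * ‖z‖⁻¹ := by
  have hz' : 0 < ‖z‖ := norm_pos_iff.2 hz
  have hr' : 0 < r := hz'.trans_le hr
  have hi : |z i| ≤ r := (PiLp.norm_apply_le z i).trans hr
  have hj : |z j| ≤ r := (PiLp.norm_apply_le z j).trans hr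
  rw [abs_mul, abs_of_pos (inv_pos.2 hr'), mul_comm]
  refine mul_le_mul ?_ (inv_anti₀ hz' hr) (by positivity) (by norm_num)
  refine (abs_sub _ _).trans ?_
  have h1 : |if i = j then (1 : ℝ) else 0| ≤ 1 := by split_ifs <;> simp
  have h2 : |z i * z j / r ^ 2| ≤ 1 := by
    rw [abs_div, abs_mul, abs_of_pos (pow_pos hr' 2), div_le_one (by positivity), sq]
    exact mul_le_mul hi hj (abs_nonneg _) hr'.le
  linarith

lemma inv_norm_locInt : LocallyIntegrable (fun z : (EuclideanSpace ℝ (Fin 3)) => 2 * ‖z‖⁻¹) := by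
  refine locallyIntegrable_of_norm_le_rpow (C := 2) (α := 1) (by simp) (by simp)
    (ae_of_all _ fun z => ?_) (by fun_prop)
  simp [Real.rpow_neg_one]

lemma regK_tendsto (z : (EuclideanSpace ℝ (Fin 3))) :
    Tendsto (fun n : ℕ => regK (1 / ((n : ℝ) + 1)) z) atTop (𝓝 ‖z‖) := by
  have h := tendsto_one_div_add_atTop_nhds_zero_nat (𝕜 := ℝ)
  have h2 := ((tendsto_const_nhds (x := ‖z‖ ^ 2)).add (h.pow 2)).sqrt
  simpa [regK] using h2

/-- For `f` smooth with compact support, the Hessian of the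
Rosenbluth potential `g = ψ⋆f` is given by convolution with the Landau kernel:
`∂_i∂_j g(v) = ∫ A_{ij}(v−w) f(w) dw`. -/
theorem hessian_rosenbluth_eq_conv_landauKernel
    (f : EuclideanSpace ℝ (Fin 3) → ℝ)
    (hf : ContDiff ℝ (⊤ : ℕ∞) f) (hsupp : HasCompactSupport f)
    (v : EuclideanSpace ℝ (Fin 3)) (i j : Fin 3) :
    pd i (pd j (fun x => ∫ u, ‖u‖ * f (x - u))) v
      = ∫ w, landauKernel (v - w) i j * f w := by
  have hne : ∀ᵐ u : EuclideanSpace ℝ (Fin 3), u ≠ 0 := by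
    simp [ae_iff]
  have he : ∀ n : ℕ, (0 : ℝ) < 1 / ((n : ℝ) + 1) := fun n => by positivity
  have he1 : ∀ n : ℕ, 1 / ((n : ℝ) + 1) ≤ 1 := fun n => by
    rw [div_le_one (by positivity)]; linarith [(Nat.cast_nonneg n : (0 : ℝ) ≤ n)]
  have hfj := pd_contDiff hf j
  have hsj := pd_hcs hsupp j
  have hfij := pd_contDiff hfj i
  have hsij := pd_hcs hsj i
  have hnorm : LocallyIntegrable (fun u : EuclideanSpace ℝ (Fin 3) => ‖u‖) :=
    continuous_norm.locallyIntegrable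
  rw [pd_conv hnorm hf hsupp, pd_conv hnorm hfj hsj]
  have key : ∀ n : ℕ, ∫ u, regK (1 / ((n : ℝ) + 1)) u * pd i (pd j f) (v - u)
      = ∫ u, pd j (pd i (regK (1 / ((n : ℝ) + 1)))) u * f (v - u) := fun n => by
    rw [ibp (regK_contDiff (he n)) hfj hsj,
      ibp (pd_contDiff (regK_contDiff (he n)) i) hf hsupp]
  have L1 : Tendsto (fun n : ℕ => ∫ u, regK (1 / ((n : ℝ) + 1)) u * pd i (pd j f) (v - u))
      atTop (𝓝 (∫ u, ‖u‖ * pd i (pd j f) (v - u))) := by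
    refine tendsto_integral_of_dominated_convergence
      (fun u => ‖(‖u‖ + 1) * pd i (pd j f) (v - u)‖) ?_ ?_ ?_ ?_
    · intro n
      exact (int_conv (regK_contDiff (he n)).continuous.locallyIntegrable hfij.continuous
        hsij v).aestronglyMeasurable
    · exact (int_conv (k := fun u => ‖u‖ + 1) (by fun_prop : Continuous _).locallyIntegrable
        hfij.continuous hsij v).norm
    · intro n
      refine ae_of_all _ fun u => ?_
      rw [norm_mul, norm_mul]
      refine mul_le_mul_of_nonneg_right ?_ (norm_nonneg _)
      rw [Real.norm_of_nonneg (regK_pos (he n) u).le, Real.norm_of_nonneg (by positivity)]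
      exact regK_le (he n) (he1 n) u
    · exact ae_of_all _ fun u => (regK_tendsto u).mul_const _
  have L2 : Tendsto (fun n : ℕ => ∫ u, pd j (pd i (regK (1 / ((n : ℝ) + 1)))) u * f (v - u))
      atTop (𝓝 (∫ u, landauKernel u i j * f (v - u))) := by
    refine tendsto_integral_of_dominated_convergence
      (fun u => ‖(2 * ‖u‖⁻¹) * f (v - u)‖) ?_ ?_ ?_ ?_
    · intro n
      exact (int_conv (pd_contDiff (pd_contDiff (regK_contDiff (he n)) i)
        j).continuous.locallyIntegrable hf.continuous hsupp v).aestronglyMeasurable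
    · exact (int_conv inv_norm_locInt hf.continuous hsupp v).norm
    · intro n
      filter_upwards [hne] with u hu
      rw [norm_mul, norm_mul]
      refine mul_le_mul_of_nonneg_right ?_ (norm_nonneg _)
      rw [pd_pd_regK (he n), Real.norm_of_nonneg (by positivity : 0 ≤ 2 * ‖u‖⁻¹)]
      exact kern_bound u hu (norm_le_regK _ u) i j
    · filter_upwards [hne] with u hu
      have hu' : ‖u‖ ≠ 0 := norm_ne_zero_iff.2 hu
      refine Tendsto.mul_const _ ?_
      simp only [pd_pd_regK (he _)]
      exact ((regK_tendsto u).inv₀ hu').mul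
        (tendsto_const_nhds.sub (tendsto_const_nhds.div ((regK_tendsto u).pow 2) (pow_ne_zero 2 hu')))
  simp only [key] at L1
  change ∫ u, ‖u‖ * pd i (pd j f) (v - u) = _
  rw [tendsto_nhds_unique L1 L2,
    ← integral_sub_left_eq_self (fun w => landauKernel (v - w) i j * f w) volume v]
  simp
end
end

section
/- Let f : ℝ³ → ℝ be smooth with compact support, let ψ(z) = ‖z‖, g = ψ⋆f, and define the Coulombian Landau operator C(f,f)(v) = ∇·(∇²g(v) ∇f(v) − ∇(Δg)(v) f(v)). Then momentum is conserved: for each i ∈ {1,2,3}, ∫_{ℝ³} C(f,f)(v) v_i dv = 0. -/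
open Real MeasureTheory
noncomputable section

abbrev E3 := EuclideanSpace ℝ (Fin 3)

lemma pd_smooth {h : E3 → ℝ} (hh : ContDiff ℝ (⊤ : ℕ∞) h) (i : Fin 3) :
    ContDiff ℝ (⊤ : ℕ∞) (pd i h) := by
  unfold pd
  exact (hh.fderiv_right (m := (⊤ : ℕ∞)) (by norm_cast)).clm_apply contDiff_const

lemma pd_supp {h : E3 → ℝ} (hh : HasCompactSupport h) (i : Fin 3) :
    HasCompactSupport (pd i h) := by
  unfold pd
  exact hh.fderiv_apply (𝕜 := ℝ) _

lemma pd_comm {h : E3 → ℝ} (hh : ContDiff ℝ (⊤ : ℕ∞) h) (i j : Fin 3) :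
    pd i (pd j h) = pd j (pd i h) := by
  funext v
  have hd : DifferentiableAt ℝ (fderiv ℝ h) v :=
    ((hh.fderiv_right (m := (⊤ : ℕ∞)) (by norm_cast)).differentiable (by simp)) v
  have hs : IsSymmSndFDerivAt ℝ h v := by
    apply hh.contDiffAt.isSymmSndFDerivAt
    simp
    exact WithTop.coe_le_coe.2 (le_top : (2 : ℕ∞) ≤ ⊤)
  unfold pd
  rw [fderiv_clm_apply hd (differentiableAt_const _), fderiv_clm_apply hd (differentiableAt_const _)]
  simpa using hs.eq _ _

lemma pd_sum {F : Fin 3 → E3 → ℝ} (hF : ∀ j, ContDiff ℝ (⊤ : ℕ∞) (F j)) (i : Fin 3) :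
    pd i (fun v => ∑ j, F j v) = fun v => ∑ j, pd i (F j) v := by
  funext v
  unfold pd
  rw [fderiv_fun_sum (fun j _ => (hF j).differentiable (by simp) v)]
  simp

lemma ibp_s12 {a b : E3 → ℝ} (ha : ContDiff ℝ (⊤ : ℕ∞) a) (hb : ContDiff ℝ (⊤ : ℕ∞) b)
    (hs : HasCompactSupport a) (i : Fin 3) :
    ∫ v, pd i a v * b v = - ∫ v, a v * pd i b v := by
  have h := integral_mul_fderiv_eq_neg_fderiv_mul_of_integrable (μ := (volume : Measure E3))
    (f := a) (g := b) (v := EuclideanSpace.single i (1:ℝ))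
    (((pd_smooth ha i).continuous.mul hb.continuous).integrable_of_hasCompactSupport
      ((pd_supp hs i).mul_right))
    ((ha.continuous.mul (pd_smooth hb i).continuous).integrable_of_hasCompactSupport
      (hs.mul_right))
    ((ha.continuous.mul hb.continuous).integrable_of_hasCompactSupport
      (hs.mul_right)) (fun x _ => ha.differentiable (by simp) x)
      (fun x _ => hb.differentiable (by simp) x)
  unfold pd
  rw [h]; simp

def cv (h : E3 → ℝ) : E3 → ℝ := fun x => ∫ u, ‖u‖ * h (x - u)

lemma cv_eq (h : E3 → ℝ) :
    cv h = convolution (fun u : E3 => ‖u‖) h (ContinuousLinearMap.mul ℝ ℝ) volume := by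
  funext x; simp [cv, convolution]

lemma cv_smooth {h : E3 → ℝ} (hh : ContDiff ℝ (⊤ : ℕ∞) h) (hs : HasCompactSupport h) :
    ContDiff ℝ (⊤ : ℕ∞) (cv h) := by
  rw [cv_eq]
  exact hs.contDiff_convolution_right _ continuous_norm.locallyIntegrable hh

lemma cv_pd {h : E3 → ℝ} (hh : ContDiff ℝ (⊤ : ℕ∞) h) (hs : HasCompactSupport h) (i : Fin 3) :
    pd i (cv h) = cv (pd i h) := by
  funext x
  have h1 := hs.hasFDerivAt_convolution_right (ContinuousLinearMap.mul ℝ ℝ)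
    (μ := (volume : Measure E3)) (f := fun u : E3 => ‖u‖) continuous_norm.locallyIntegrable
    (hh.of_le (by exact_mod_cast le_top)) x
  rw [← cv_eq] at h1
  unfold pd
  rw [h1.fderiv]
  rw [convolution_precompR_apply]
  · rw [cv_eq]
  · exact continuous_norm.locallyIntegrable
  · exact hs.fderiv (𝕜 := ℝ)
  · exact hh.continuous_fderiv (by simp)

lemma cv_eq' (h : E3 → ℝ) (x : E3) : cv h x = ∫ y, ‖x - y‖ * h y := by
  unfold cv
  rw [← integral_sub_left_eq_self _ volume x]
  simp

lemma cv_symm {a b : E3 → ℝ} (ha : Continuous a) (hb : Continuous b)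
    (sa : HasCompactSupport a) (sb : HasCompactSupport b) :
    ∫ v, a v * cv b v = ∫ v, b v * cv a v := by
  simp only [cv_eq', ← integral_const_mul]
  rw [integral_integral_swap_of_hasCompactSupport]
  · congr 1; funext y; congr 1; funext x
    rw [norm_sub_rev]; ring
  · fun_prop
  · apply HasCompactSupport.intro (sa.prod sb)
    rintro ⟨x, y⟩ hxy
    simp only [Set.mem_prod, not_and_or] at hxy
    rcases hxy with h | h
    · simp [Function.uncurry, image_eq_zero_of_notMem_tsupport h]
    · simp [Function.uncurry, image_eq_zero_of_notMem_tsupport h]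

lemma key {f : E3 → ℝ} (hf : ContDiff ℝ (⊤ : ℕ∞) f) (hs : HasCompactSupport f) (i j : Fin 3) :
    ∫ v, f v * pd i (pd j (pd j (cv f))) v = 0 := by
  have f1 := pd_smooth hf j
  have s1 := pd_supp hs j
  have f2 := pd_smooth f1 j
  have s2 := pd_supp s1 j
  have f3 := pd_smooth f2 i
  have s3 := pd_supp s2 i
  have g := cv_smooth hf hs
  have e : pd i (pd j (pd j (cv f))) = cv (pd i (pd j (pd j f))) := by
    rw [cv_pd hf hs, cv_pd f1 s1, cv_pd f2 s2]
  have h1 : ∫ v, f v * pd i (pd j (pd j (cv f))) v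
      = ∫ v, pd i (pd j (pd j f)) v * cv f v := by
    rw [e, cv_symm hf.continuous f3.continuous hs s3]
  have h2 : ∫ v, pd i (pd j (pd j f)) v * cv f v
      = - ∫ v, f v * pd i (pd j (pd j (cv f))) v := by
    rw [ibp_s12 f2 g s2, ibp_s12 f1 (pd_smooth g i) s1, ibp_s12 hf (pd_smooth (pd_smooth g i) j) hs,
      pd_comm g j i, pd_comm (pd_smooth g j) j i]
    simp
  linarith

lemma pd_coord (i k : Fin 3) : pd k (fun v : E3 => v i) = fun _ => if k = i then 1 else 0 := by
  funext v
  unfold pd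
  have : (fun v : E3 => v i) = (EuclideanSpace.proj i : E3 →L[ℝ] ℝ) := by ext; simp
  rw [this, ContinuousLinearMap.fderiv]
  simp [eq_comm]

theorem landauOp_conserves_momentum
    (f : EuclideanSpace ℝ (Fin 3) → ℝ)
    (hf : ContDiff ℝ (⊤ : ℕ∞) f) (hsupp : HasCompactSupport f) (i : Fin 3) :
    ∫ v, landauOp (fun x => ∫ u, ‖u‖ * f (x - u)) f v * v i = 0 := by
  change ∫ v, landauOp (cv f) f v * v i = 0
  have g := cv_smooth hf hsupp
  have hlap : ∀ k, pd k (lap (cv f)) = fun v => ∑ j, pd k (pd j (pd j (cv f))) v := fun k =>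
    pd_sum (fun j => pd_smooth (pd_smooth g j) j) k
  unfold landauOp
  simp only [hlap]
  set F : Fin 3 → E3 → ℝ := fun k w => (∑ j, pd k (pd j (cv f)) w * pd j f w)
    - (∑ j, pd k (pd j (pd j (cv f))) w) * f w with hF
  have A : ∀ k j, ContDiff ℝ (⊤ : ℕ∞) (pd k (pd j (cv f))) :=
    fun k j => pd_smooth (pd_smooth g j) k
  have B : ∀ k j, ContDiff ℝ (⊤ : ℕ∞) (pd k (pd j (pd j (cv f)))) :=
    fun k j => pd_smooth (A j j) k
  have C : ∀ j, ContDiff ℝ (⊤ : ℕ∞) (pd j f) := pd_smooth hf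
  have Fs : ∀ k, ContDiff ℝ (⊤ : ℕ∞) (F k) := fun k =>
    (ContDiff.sum fun j _ => (A k j).mul (C j)).sub ((ContDiff.sum fun j _ => B k j).mul hf)
  have Fc : ∀ k, HasCompactSupport (F k) := by
    intro k
    apply HasCompactSupport.intro hsupp
    intro x hx
    have h0 : ∀ j, pd j f x = 0 := fun j => by
      unfold pd
      rw [fderiv_of_notMem_tsupport (𝕜 := ℝ) hx]; simp
    simp [hF, h0, image_eq_zero_of_notMem_tsupport hx]
  have cs : ContDiff ℝ (⊤ : ℕ∞) (fun v : E3 => v i) := by fun_prop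
  change ∫ v : E3, (∑ k, pd k (F k) v) * v i = 0
  simp only [Finset.sum_mul]
  rw [integral_finsetSum]
  swap
  · intro k _
    exact ((pd_smooth (Fs k) k).continuous.mul cs.continuous).integrable_of_hasCompactSupport
      ((pd_supp (Fc k) k).mul_right)
  have e1 : ∀ k, ∫ v, pd k (F k) v * v i = - ∫ v, F k v * (if k = i then 1 else 0) := by
    intro k
    rw [ibp_s12 (Fs k) cs (Fc k) k, pd_coord]
  have e2 : ∫ v, F i v = 0 := by
    have I1 : ∀ j, Integrable (fun w => pd i (pd j (cv f)) w * pd j f w) := fun j =>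
      ((A i j).continuous.mul (C j).continuous).integrable_of_hasCompactSupport
        ((pd_supp hsupp j).mul_left)
    have I2 : ∀ j, Integrable (fun w => pd i (pd j (pd j (cv f))) w * f w) := fun j =>
      ((B i j).continuous.mul hf.continuous).integrable_of_hasCompactSupport
        (hsupp.mul_left)
    simp only [hF, Finset.sum_mul]
    rw [integral_sub (integrable_finsetSum _ fun j _ => I1 j)
      (integrable_finsetSum _ fun j _ => I2 j), integral_finsetSum _ fun j _ => I1 j,
      integral_finsetSum _ fun j _ => I2 j]
    have z2 : ∀ j, ∫ w, pd i (pd j (pd j (cv f))) w * f w = 0 := fun j => by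
      rw [← key hf hsupp i j]; simp only [mul_comm]
    have z1 : ∀ j, ∫ w, pd i (pd j (cv f)) w * pd j f w = 0 := fun j => by
      have := ibp_s12 hf (A i j) hsupp j
      rw [pd_comm (pd_smooth g j) j i, key hf hsupp i j] at this
      simpa [mul_comm] using this
    simp [z1, z2]
  apply Finset.sum_eq_zero
  intro k _
  rw [e1]
  by_cases hk : k = i
  · subst hk; simp [e2]
  · simp [hk]
end
end

section
/- Let ρ > 0, θ > 0 and u ∈ ℝ³, let M(v) = ρ (2πθ)^{−3/2} exp(−‖v−u‖²/(2θ)) be the Maxwellian distribution, let ψ(z) = ‖z‖ and g_M = ψ⋆M (which is finite and smooth since M has Gaussian decay). Then the Maxwellian is an equilibrium of the Coulombian Landau operator in Rosenbluth form: for every v ∈ ℝ³, ∇·(∇²g_M(v) ∇M(v) − ∇(Δg_M)(v) M(v)) = 0. -/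
open Real MeasureTheory
noncomputable section

/-- The Maxwellian distribution with mass `ρ`, mean velocity `u` and squared
thermal velocity `θ`. -/
def maxwellian (ρ θ : ℝ) (u : EuclideanSpace ℝ (Fin 3)) :
    EuclideanSpace ℝ (Fin 3) → ℝ :=
  fun v => ρ * (2 * π * θ) ^ (-(3 : ℝ) / 2) * Real.exp (-‖v - u‖ ^ 2 / (2 * θ))

lemma maxwellian_hasFDerivAt (ρ θ : ℝ) (u x : E3) :
    HasFDerivAt (maxwellian ρ θ u)
      ((-(maxwellian ρ θ u x) / θ) • (innerSL ℝ (x - u))) x := by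
  have h1 : HasFDerivAt (fun x : E3 => ‖x - u‖ ^ 2) (2 • (innerSL ℝ (x - u))) x := by
    have := ((hasFDerivAt_id x).sub_const u).norm_sq
    simpa using this
  have h2 := (((h1.neg.mul_const (2 * θ)⁻¹).exp).const_mul (ρ * (2 * π * θ) ^ (-(3 : ℝ) / 2)))
  have h3 : maxwellian ρ θ u = fun y => ρ * (2 * π * θ) ^ (-(3 : ℝ) / 2) *
      Real.exp ((-fun x : E3 => ‖x - u‖ ^ 2) y * (2 * θ)⁻¹) := by
    funext y
    simp [maxwellian, div_eq_mul_inv]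
  rw [h3]
  refine h2.congr_fderiv ?_
  ext y
  simp
  ring

lemma maxwellian_contDiff (ρ θ : ℝ) (u : E3) : ContDiff ℝ 1 (maxwellian ρ θ u) := by
  unfold maxwellian
  have : ContDiff ℝ 1 (fun x : E3 => ‖x - u‖ ^ 2) := (contDiff_id.sub contDiff_const).norm_sq ℝ
  fun_prop

lemma one_add_norm_le (a b : E3) : 1 + ‖a‖ ≤ (1 + ‖b‖) * (1 + ‖a - b‖) := by
  have : ‖a‖ ≤ ‖a - b‖ + ‖b‖ := by simpa using norm_add_le (a - b) b
  nlinarith [norm_nonneg b, norm_nonneg (a - b), mul_nonneg (norm_nonneg b) (norm_nonneg (a - b))]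

lemma maxwellian_decay (ρ θ : ℝ) (hρ : 0 < ρ) (hθ : 0 < θ) (u : E3) (k : ℕ) :
    ∃ C, 0 ≤ C ∧ ∀ x, (1 + ‖x‖) ^ k * maxwellian ρ θ u x ≤ C := by
  set c := ρ * (2 * π * θ) ^ (-(3 : ℝ) / 2) with hc
  have hc0 : 0 ≤ c := by positivity
  refine ⟨(1 + ‖u‖) ^ k * (k.factorial * Real.exp (1 + θ / 2)) * c, by positivity, fun x => ?_⟩
  have h1 : (1 + ‖x‖) ^ k ≤ (1 + ‖u‖) ^ k * (1 + ‖x - u‖) ^ k := by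
    rw [← mul_pow]
    gcongr
    exact one_add_norm_le x u
  set t := ‖x - u‖ with ht
  have ht0 : 0 ≤ t := norm_nonneg _
  have h2 : (1 + t) ^ k ≤ k.factorial * Real.exp (1 + t) := by
    have := Real.pow_div_factorial_le_exp (1 + t) (by positivity) k
    rw [div_le_iff₀ (by positivity)] at this
    linarith
  have h3 : Real.exp (1 + t) * Real.exp (-t ^ 2 / (2 * θ)) ≤ Real.exp (1 + θ / 2) := by
    rw [← Real.exp_add]
    apply Real.exp_le_exp.2
    have : 1 + θ / 2 - (1 + t + -t ^ 2 / (2 * θ)) = (t - θ) ^ 2 / (2 * θ) := by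
      field_simp
      ring
    have : 0 ≤ (t - θ) ^ 2 / (2 * θ) := by positivity
    linarith
  unfold maxwellian
  rw [← hc, ← ht]
  calc (1 + ‖x‖) ^ k * (c * Real.exp (-t ^ 2 / (2 * θ)))
      ≤ ((1 + ‖u‖) ^ k * (k.factorial * Real.exp (1 + t))) * (c * Real.exp (-t ^ 2 / (2 * θ))) := by
        gcongr
        exact h1.trans (by gcongr)
    _ = (1 + ‖u‖) ^ k * (k.factorial * (Real.exp (1 + t) * Real.exp (-t ^ 2 / (2 * θ)))) * c := by
        ring
    _ ≤ _ := by gcongr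

/-- C¹ functions decaying fast with their derivative. -/
def Nice (F : E3 → ℝ) : Prop :=
  ContDiff ℝ 1 F ∧ ∃ C, 0 ≤ C ∧ (∀ x, (1 + ‖x‖) ^ 6 * |F x| ≤ C) ∧
    ∀ x, (1 + ‖x‖) ^ 6 * ‖fderiv ℝ F x‖ ≤ C

lemma maxwellian_nonneg (ρ θ : ℝ) (hρ : 0 < ρ) (hθ : 0 < θ) (u x : E3) :
    0 ≤ maxwellian ρ θ u x := by unfold maxwellian; positivity

lemma fderiv_mul_maxwellian (ρ θ : ℝ) (u : E3) {p : E3 → ℝ} (x : E3)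
    (hp : DifferentiableAt ℝ p x) :
    fderiv ℝ (fun x => p x * maxwellian ρ θ u x) x =
      p x • ((-(maxwellian ρ θ u x) / θ) • (innerSL ℝ (x - u))) +
       maxwellian ρ θ u x • fderiv ℝ p x :=
  (hp.hasFDerivAt.mul (maxwellian_hasFDerivAt ρ θ u x)).fderiv

lemma nice_mul (ρ θ : ℝ) (hρ : 0 < ρ) (hθ : 0 < θ) (u : E3) {p : E3 → ℝ}
    (hp : p.HasTemperateGrowth) : Nice (fun x => p x * maxwellian ρ θ u x) := by
  obtain ⟨k, C, hC0, hC⟩ := hp.norm_iteratedFDeriv_le_uniform 1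
  have hC1 : ∀ x, |p x| ≤ C * (1 + ‖x‖) ^ k := fun x => by
    simpa using hC 0 (by norm_num) x
  have hC2 : ∀ x, ‖fderiv ℝ p x‖ ≤ C * (1 + ‖x‖) ^ k := fun x => by
    have := hC 1 (by norm_num) x
    rwa [norm_iteratedFDeriv_one] at this
  have hp1 : ContDiff ℝ 1 p := hp.1.of_le (by exact_mod_cast le_top)
  obtain ⟨D, hD0, hD⟩ := maxwellian_decay ρ θ hρ hθ u (6 + k)
  obtain ⟨D', hD'0, hD'⟩ := maxwellian_decay ρ θ hρ hθ u (7 + k)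
  refine ⟨hp1.mul (maxwellian_contDiff ρ θ u), C * D + (C * D' * (1 + ‖u‖) / θ) , by positivity,
    fun x => ?_, fun x => ?_⟩
  · have hM := maxwellian_nonneg ρ θ hρ hθ u x
    rw [abs_mul, abs_of_nonneg hM]
    calc _ ≤ (1 + ‖x‖) ^ 6 * ((C * (1 + ‖x‖) ^ k) * maxwellian ρ θ u x) := by
          gcongr; exact hC1 x
      _ = C * ((1 + ‖x‖) ^ (6 + k) * maxwellian ρ θ u x) := by ring
      _ ≤ C * D := by gcongr; exact hD x
      _ ≤ _ := le_add_of_nonneg_right (by positivity)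
  · have hM := maxwellian_nonneg ρ θ hρ hθ u x
    rw [fderiv_mul_maxwellian ρ θ u x (hp1.differentiable (by norm_num) x)]
    have h1 : ‖p x • ((-(maxwellian ρ θ u x) / θ) • (innerSL ℝ (x - u))) +
       maxwellian ρ θ u x • fderiv ℝ p x‖ ≤ (C * (1 + ‖x‖) ^ k) * ((maxwellian ρ θ u x / θ) *
         ((1 + ‖u‖) * (1 + ‖x‖))) + maxwellian ρ θ u x * (C * (1 + ‖x‖) ^ k) := by
      refine (norm_add_le _ _).trans ?_
      simp only [norm_smul, norm_div, norm_neg, Real.norm_eq_abs, abs_of_nonneg hM,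
        abs_of_pos hθ, innerSL_apply_norm]
      have h3 : ‖x - u‖ ≤ (1 + ‖u‖) * (1 + ‖x‖) := by
        nlinarith [norm_sub_le x u, norm_nonneg x, norm_nonneg u, mul_nonneg (norm_nonneg u) (norm_nonneg x)]
      have h4 := hC1 x
      have h5 := hC2 x
      gcongr
    calc _ ≤ (1 + ‖x‖) ^ 6 * _ := mul_le_mul_of_nonneg_left h1 (by positivity)
      _ = C * ((1 + ‖x‖) ^ (6 + k) * maxwellian ρ θ u x) +
          (C * ((1 + ‖x‖) ^ (7 + k) * maxwellian ρ θ u x) * (1 + ‖u‖) / θ) := by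
            field_simp
            ring
      _ ≤ _ := by gcongr; exact hD x; exact hD' x

lemma integrable_bracket : Integrable (fun z : E3 => (((1 + ‖z‖) ^ 4)⁻¹ : ℝ)) := by
  have := integrable_one_add_norm (E := E3) (μ := volume) (r := 4) (by simp; norm_num)
  refine this.congr (Filter.Eventually.of_forall fun z => ?_)
  simp only
  rw [Real.rpow_neg (by positivity)]
  norm_cast

/-- Convolution with the norm. -/
def T (F : E3 → ℝ) (x : E3) : ℝ := ∫ z, ‖z‖ * F (x - z)

lemma decay_bound {C R : ℝ} (z y : E3) (N : ℝ) (hN : (1 + ‖y‖) ^ 6 * N ≤ C)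
    (hN0 : 0 ≤ N) (hy : 1 + ‖z‖ ≤ R * (1 + ‖y‖)) :
    (1 + ‖z‖) ^ 2 * N ≤ C * R ^ 6 * ((1 + ‖z‖) ^ 4)⁻¹ := by
  rw [← div_eq_mul_inv, le_div_iff₀ (by positivity)]
  calc _ = (1 + ‖z‖) ^ 6 * N := by ring
    _ ≤ (R * (1 + ‖y‖)) ^ 6 * N := by gcongr
    _ = R ^ 6 * ((1 + ‖y‖) ^ 6 * N) := by ring
    _ ≤ R ^ 6 * C := by gcongr
    _ = _ := by ring

lemma one_add_le_sub (x z : E3) : 1 + ‖z‖ ≤ (1 + ‖x‖) * (1 + ‖x - z‖) := by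
  have := one_add_norm_le z x
  rwa [norm_sub_rev] at this

lemma T_integrable {F : E3 → ℝ} (hF : Nice F) (x : E3) :
    Integrable (fun z => ‖z‖ * F (x - z)) := by
  obtain ⟨h1, C, hC, h2, h3⟩ := hF
  have hc := h1.continuous
  refine (integrable_bracket.const_mul (C * (1 + ‖x‖) ^ 6)).mono' (by fun_prop)
    (Filter.Eventually.of_forall fun z => ?_)
  refine le_trans ?_ (decay_bound z (x - z) _ (h2 (x - z)) (abs_nonneg _) (one_add_le_sub x z))
  rw [norm_mul, norm_norm, Real.norm_eq_abs]
  gcongr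
  nlinarith [norm_nonneg z]

lemma T_hasFDerivAt {F : E3 → ℝ} (hF : Nice F) (x : E3) :
    Integrable (fun z => ‖z‖ • fderiv ℝ F (x - z)) ∧
    HasFDerivAt (T F) (∫ z, ‖z‖ • fderiv ℝ F (x - z)) x := by
  have hI := T_integrable hF x
  obtain ⟨h1, C, hC, h2, h3⟩ := hF
  have hc := h1.continuous
  have hc' : Continuous (fderiv ℝ F) := h1.continuous_fderiv (by norm_num)
  have hb : ∀ z : E3, ∀ y ∈ Metric.ball x 1, ‖‖z‖ • fderiv ℝ F (y - z)‖ ≤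
      C * (2 + ‖x‖) ^ 6 * ((1 + ‖z‖) ^ 4)⁻¹ := by
    intro z y hy
    have hy' : ‖y‖ ≤ 1 + ‖x‖ := by
      have h4 : ‖y - x‖ < 1 := by simpa [dist_eq_norm] using hy
      have : ‖y‖ ≤ ‖y - x‖ + ‖x‖ := by simpa using norm_add_le (y - x) x
      linarith
    refine le_trans ?_ (decay_bound (R := 2 + ‖x‖) z (y - z) _ (h3 (y - z)) (norm_nonneg _) ?_)
    · rw [norm_smul, norm_norm]
      gcongr
      nlinarith [norm_nonneg z]
    · exact (one_add_le_sub y z).trans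
        (mul_le_mul_of_nonneg_right (by linarith) (by positivity))
  have hbi := integrable_bracket.const_mul (C * (2 + ‖x‖) ^ 6)
  refine ⟨hbi.mono' (by fun_prop) (Filter.Eventually.of_forall fun z =>
    hb z x (Metric.mem_ball_self one_pos)), ?_⟩
  unfold T
  refine hasFDerivAt_integral_of_dominated_of_fderiv_le
    (F := fun x z => ‖z‖ * F (x - z)) (F' := fun x z => ‖z‖ • fderiv ℝ F (x - z))
    (Metric.ball_mem_nhds x one_pos)
    (Filter.Eventually.of_forall fun y => by fun_prop) hI (by fun_prop)
    (Filter.Eventually.of_forall hb) hbi (Filter.Eventually.of_forall fun z y _ => ?_)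
  have h4 := ((h1.differentiable (by norm_num) (y - z)).hasFDerivAt.comp y
    ((hasFDerivAt_id y).sub_const z))
  simpa using h4.const_mul ‖z‖

lemma pd_T {F : E3 → ℝ} (hF : Nice F) (i : Fin 3) : pd i (T F) = T (pd i F) := by
  funext x
  obtain ⟨h1, h2⟩ := T_hasFDerivAt hF x
  simp only [pd, h2.fderiv, T]
  rw [ContinuousLinearMap.integral_apply h1]
  simp

lemma euler_T {F : E3 → ℝ} (hF : Nice F) (x : E3) :
    Integrable (fun z => ‖z‖ * fderiv ℝ F (x - z) z) ∧
    ∫ z, ‖z‖ * fderiv ℝ F (x - z) z = 4 * T F x := by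
  have hI := T_integrable hF x
  obtain ⟨h1, C, hC, h2, h3⟩ := hF
  have hc := h1.continuous
  have hc' : Continuous (fderiv ℝ F) := h1.continuous_fderiv (by norm_num)
  have key := hasDerivAt_integral_of_dominated_loc_of_deriv_le (μ := (volume : Measure E3))
    (F := fun (l : ℝ) z => ‖z‖ * F (x - l • z)) (x₀ := 1) (s := Set.Ioi (1 / 2))
    (F' := fun l z => - (‖z‖ * fderiv ℝ F (x - l • z) z))
    (bound := fun z => C * (2 * (1 + ‖x‖)) ^ 6 * ((1 + ‖z‖) ^ 4)⁻¹)
    (Ioi_mem_nhds (by norm_num))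
    (Filter.Eventually.of_forall fun l => by fun_prop) (by simpa using hI)
    (Continuous.aestronglyMeasurable (by fun_prop))
    (Filter.Eventually.of_forall fun z l hl => by
      have hl : (1 / 2 : ℝ) < l := hl
      refine le_trans ?_ (decay_bound (R := 2 * (1 + ‖x‖)) z (x - l • z) _ (h3 _) (norm_nonneg _) ?_)
      · rw [norm_neg, norm_mul, norm_norm]
        calc _ ≤ ‖z‖ * (‖fderiv ℝ F (x - l • z)‖ * ‖z‖) := by
              gcongr; exact ContinuousLinearMap.le_opNorm _ _
          _ = ‖z‖ ^ 2 * ‖fderiv ℝ F (x - l • z)‖ := by ring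
          _ ≤ _ := by gcongr; linarith
      · have := one_add_le_sub x (l • z)
        rw [norm_smul, Real.norm_eq_abs, abs_of_pos (by linarith)] at this
        nlinarith [norm_nonneg z])
    (integrable_bracket.const_mul _)
    (Filter.Eventually.of_forall fun z l _ => by
      have h4 : HasDerivAt (fun l : ℝ => x - l • z) (-z) l := by
        simpa using ((hasDerivAt_id l).smul_const z).const_sub x
      have h5 := ((h1.differentiable (by norm_num) (x - l • z)).hasFDerivAt.comp_hasDerivAt l h4)
      simpa using h5.const_mul ‖z‖)
  obtain ⟨k1, k2⟩ := key
  simp only [one_smul] at k1 k2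
  refine ⟨by simpa using k1.neg, ?_⟩
  have k3 : HasDerivAt (fun l : ℝ => (l ^ 4)⁻¹ * T F x) (-4 * T F x) 1 := by
    have := ((hasDerivAt_pow 4 (1 : ℝ)).inv (by norm_num)).mul_const (T F x)
    simpa using this
  have k4 : (fun l : ℝ => ∫ z, ‖z‖ * F (x - l • z)) =ᶠ[nhds 1] fun l : ℝ => (l ^ 4)⁻¹ * T F x := by
    filter_upwards [Ioi_mem_nhds (show (0 : ℝ) < 1 by norm_num)] with l hl
    have hl : 0 < l := hl
    have := Measure.integral_comp_smul_of_nonneg (volume : Measure E3)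
      (fun z => ‖z‖ * F (x - z)) l (hR := hl.le)
    simp only [norm_smul, Real.norm_eq_abs, abs_of_pos hl, mul_assoc, integral_const_mul,
      finrank_euclideanSpace, Fintype.card_fin, smul_eq_mul] at this
    unfold T
    rw [pow_succ, mul_inv]
    have h6 := congrArg (fun t => l⁻¹ * t) this
    rw [inv_mul_cancel_left₀ hl.ne'] at h6
    rw [h6]; ring
  have k5 := k2.unique (k3.congr_of_eventuallyEq k4)
  rw [integral_neg] at k5
  linarith

lemma coord_hasFDerivAt (u x : E3) (j : Fin 3) :
    HasFDerivAt (fun x : E3 => x j - u j) (EuclideanSpace.proj j : E3 →L[ℝ] ℝ) x := by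
  have := (EuclideanSpace.proj j : E3 →L[ℝ] ℝ).hasFDerivAt (x := x)
  exact this.sub_const (u j)

lemma coord_temperate (u : E3) (j : Fin 3) :
    Function.HasTemperateGrowth (fun x : E3 => x j - u j) := by
  have := (EuclideanSpace.proj j : E3 →L[ℝ] ℝ).hasTemperateGrowth
  exact this.sub (.const (u j))

lemma pd_mul (ρ θ : ℝ) (u : E3) {p : E3 → ℝ} (i : Fin 3) (x : E3) {p' : E3 →L[ℝ] ℝ}
    (hp : HasFDerivAt p p' x) :
    pd i (fun x => p x * maxwellian ρ θ u x) x =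
      (p' (EuclideanSpace.single i 1) - p x * (x i - u i) / θ) * maxwellian ρ θ u x := by
  unfold pd
  rw [fderiv_mul_maxwellian ρ θ u x hp.differentiableAt, hp.fderiv]
  simp [EuclideanSpace.inner_single_right]
  ring

lemma pd1 (ρ θ : ℝ) (u : E3) (j : Fin 3) :
    pd j (maxwellian ρ θ u) = fun x => (-(x j - u j) / θ) * maxwellian ρ θ u x := by
  funext x
  have := pd_mul ρ θ u j x (hasFDerivAt_const (1 : ℝ) x)
  simp only [one_mul] at this
  rw [show maxwellian ρ θ u = fun x => maxwellian ρ θ u x from rfl, this]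
  simp
  ring_nf

lemma pd2 (ρ θ : ℝ) (u : E3) (i j : Fin 3) :
    pd i (pd j (maxwellian ρ θ u)) = fun x =>
      (-(if i = j then 1 else 0) / θ + (x i - u i) * (x j - u j) / θ ^ 2)
        * maxwellian ρ θ u x := by
  funext x
  rw [pd1]
  have h := ((coord_hasFDerivAt u x j).neg.mul_const θ⁻¹)
  have := pd_mul ρ θ u i x h
  simp only [Pi.neg_apply, ← div_eq_mul_inv] at this
  rw [this]
  by_cases hij : i = j
  · subst hij
    simp
    left
    ring
  · have hji : ¬ j = i := fun h => hij h.symm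
    simp [hij, hji]
    ring

lemma lapM (ρ θ : ℝ) (u : E3) :
    lap (maxwellian ρ θ u) = fun x =>
      (-3 / θ + ((x 0 - u 0) ^ 2 + (x 1 - u 1) ^ 2 + (x 2 - u 2) ^ 2) / θ ^ 2)
        * maxwellian ρ θ u x := by
  funext x
  simp only [lap, pd2, Fin.sum_univ_three, if_true]
  ring

lemma pd_lapM (ρ θ : ℝ) (u : E3) (i : Fin 3) :
    pd i (lap (maxwellian ρ θ u)) = fun x =>
      (2 * (x i - u i) / θ ^ 2 - (-3 / θ + ((x 0 - u 0) ^ 2 + (x 1 - u 1) ^ 2 + (x 2 - u 2) ^ 2)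
        / θ ^ 2) * (x i - u i) / θ) * maxwellian ρ θ u x := by
  funext x
  rw [lapM]
  have h := (((((coord_hasFDerivAt u x 0).pow 2).add ((coord_hasFDerivAt u x 1).pow 2)).add
    ((coord_hasFDerivAt u x 2).pow 2)).mul_const (θ ^ 2)⁻¹).const_add (-3 / θ)
  have := pd_mul ρ θ u i x h
  simp only [Pi.add_apply, ← div_eq_mul_inv] at this
  rw [this]
  fin_cases i <;> simp <;> left <;> ring

lemma temp_div {p : E3 → ℝ} (hp : p.HasTemperateGrowth) (c : ℝ) :
    Function.HasTemperateGrowth (fun x => p x / c) := by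
  simp only [div_eq_mul_inv]
  exact hp.mul (.const _)

lemma nice0 (ρ θ : ℝ) (hρ : 0 < ρ) (hθ : 0 < θ) (u : E3) : Nice (maxwellian ρ θ u) := by
  simpa using nice_mul ρ θ hρ hθ u (.const (1 : ℝ))

lemma nice1 (ρ θ : ℝ) (hρ : 0 < ρ) (hθ : 0 < θ) (u : E3) (j : Fin 3) :
    Nice (pd j (maxwellian ρ θ u)) := by
  rw [pd1]
  exact nice_mul ρ θ hρ hθ u (temp_div (coord_temperate u j).neg θ)

lemma nice2 (ρ θ : ℝ) (hρ : 0 < ρ) (hθ : 0 < θ) (u : E3) (i j : Fin 3) :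
    Nice (pd i (pd j (maxwellian ρ θ u))) := by
  rw [pd2]
  exact nice_mul ρ θ hρ hθ u ((Function.HasTemperateGrowth.const _).add
    (temp_div ((coord_temperate u i).mul (coord_temperate u j)) _))

lemma nice_lap (ρ θ : ℝ) (hρ : 0 < ρ) (hθ : 0 < θ) (u : E3) :
    Nice (lap (maxwellian ρ θ u)) := by
  rw [lapM]
  exact nice_mul ρ θ hρ hθ u ((Function.HasTemperateGrowth.const _).add
    (temp_div ((((coord_temperate u 0).pow 2).add ((coord_temperate u 1).pow 2)).add
      ((coord_temperate u 2).pow 2)) _))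

lemma nice3 (ρ θ : ℝ) (hρ : 0 < ρ) (hθ : 0 < θ) (u : E3) (i : Fin 3) :
    Nice (pd i (lap (maxwellian ρ θ u))) := by
  rw [pd_lapM]
  have h := (Function.HasTemperateGrowth.const (E := E3) (-3 / θ)).add
    (temp_div ((((coord_temperate u 0).pow 2).add ((coord_temperate u 1).pow 2)).add
      ((coord_temperate u 2).pow 2)) (θ ^ 2))
  exact nice_mul ρ θ hρ hθ u
    ((temp_div ((Function.HasTemperateGrowth.const (E := E3) (2 : ℝ)).mul (coord_temperate u i))
      (θ ^ 2)).sub (temp_div (h.mul (coord_temperate u i)) θ))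

lemma fderiv_eq_sum (F : E3 → ℝ) (x z : E3) :
    fderiv ℝ F x z = ∑ j, z j * pd j F x := by
  have : z = ∑ j, z j • EuclideanSpace.single j (1 : ℝ) := by
    ext k
    simp [Pi.single_apply]
  conv_lhs => rw [this]
  simp [pd]

lemma lap_T (ρ θ : ℝ) (hρ : 0 < ρ) (hθ : 0 < θ) (u : E3) :
    lap (T (maxwellian ρ θ u)) = T (lap (maxwellian ρ θ u)) := by
  funext x
  simp only [lap, pd_T (nice0 ρ θ hρ hθ u), pd_T (nice1 ρ θ hρ hθ u _)]
  simp only [T, lap, Finset.mul_sum]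
  rw [integral_finsetSum]
  exact fun j _ => T_integrable (nice2 ρ θ hρ hθ u j j) x

lemma flux_zero (ρ θ : ℝ) (hρ : 0 < ρ) (hθ : 0 < θ) (u : E3) (i : Fin 3) (w : E3) :
    (∑ j, pd i (pd j (T (maxwellian ρ θ u))) w * pd j (maxwellian ρ θ u) w)
      - pd i (lap (T (maxwellian ρ θ u))) w * maxwellian ρ θ u w = 0 := by
  simp only [lap_T ρ θ hρ hθ u, pd_T (nice0 ρ θ hρ hθ u), pd_T (nice1 ρ θ hρ hθ u _),
    pd_T (nice_lap ρ θ hρ hθ u)]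
  obtain ⟨h1, h2⟩ := euler_T (nice1 ρ θ hρ hθ u i) w
  have hI3 := T_integrable (nice3 ρ θ hρ hθ u i) w
  have hI2 := fun j => T_integrable (nice2 ρ θ hρ hθ u i j) w
  have key : ∑ j, T (pd i (pd j (maxwellian ρ θ u))) w * (w j - u j)
      + θ * T (pd i (lap (maxwellian ρ θ u))) w = 0 := by
    have e : ∀ z : E3, ‖z‖ * fderiv ℝ (pd i (maxwellian ρ θ u)) (w - z) z
        - 4 * (‖z‖ * pd i (maxwellian ρ θ u) (w - z)) =
        ∑ j, (‖z‖ * pd i (pd j (maxwellian ρ θ u)) (w - z)) * (w j - u j)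
        + θ * (‖z‖ * pd i (lap (maxwellian ρ θ u)) (w - z)) := by
      intro z
      rw [fderiv_eq_sum, pd_lapM]
      simp only [pd2]
      simp only [pd1, Fin.sum_univ_three, PiLp.sub_apply]
      fin_cases i <;> simp <;> field_simp <;> ring
    have e2 := integral_congr_ae (μ := (volume : Measure E3)) (Filter.Eventually.of_forall e)
    rw [integral_sub h1 ((T_integrable (nice1 ρ θ hρ hθ u i) w).const_mul 4), h2,
      integral_add (integrable_finsetSum _ fun j _ => (hI2 j).mul_const _) (hI3.const_mul θ),
      integral_finsetSum _ (fun j _ => (hI2 j).mul_const _), integral_const_mul,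
      integral_const_mul] at e2
    simp only [integral_mul_const] at e2
    unfold T at e2 ⊢
    linarith
  simp only [pd1 ρ θ u]
  simp only [← pd1 ρ θ u]
  have : (∑ j, T (pd i (pd j (maxwellian ρ θ u))) w * (-(w j - u j) / θ * maxwellian ρ θ u w))
      = -(maxwellian ρ θ u w / θ) * ∑ j, T (pd i (pd j (maxwellian ρ θ u))) w * (w j - u j) := by
    rw [Finset.mul_sum]
    exact Finset.sum_congr rfl fun j _ => by ring
  rw [this, eq_neg_of_add_eq_zero_left key]
  field_simp
  ring

/-- The Maxwellian is an equilibrium of the Coulombian Landau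
operator in Rosenbluth form: `∇·(∇²g_M ∇M − ∇(Δg_M) M) = 0` where `g_M = ψ⋆M`. -/
theorem maxwellian_is_equilibrium
    (ρ θ : ℝ) (hρ : 0 < ρ) (hθ : 0 < θ) (u : EuclideanSpace ℝ (Fin 3))
    (v : EuclideanSpace ℝ (Fin 3)) :
    landauOp (fun x => ∫ z, ‖z‖ * maxwellian ρ θ u (x - z))
      (maxwellian ρ θ u) v = 0 := by
  
  have h : (fun x => ∫ z, ‖z‖ * maxwellian ρ θ u (x - z)) = T (maxwellian ρ θ u) := rfl
  rw [h]
  unfold landauOp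
  simp only [flux_zero ρ θ hρ hθ u]
  simp [pd]
end
end
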